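/- Let L(φ) be a finite linear combination of complete contractions of degree σ in which every factor is ∂^{(2,2)}φ. Then there exists a finite linear combination Ch(φ) of σ-Chern polynomials I_{k_1,…,k_m}(φ) with k_1+…+k_m = σ such that L(φ) = Ch(φ) + L^♯(φ), where L^♯(φ) is a finite linear combination of complete contractions of degree σ in factors ∂^{(2,2)}φ each of whose terms has at least one factor containing no trace. -/

import Mathlib

open MeasureTheory

noncomputable section

namespace KahlerInv

/-- The Wirtinger holomorphic derivative `∂/∂z_a` on `ℂⁿ`. -/
def dz (n : ℕ) (a : Fin n) (f : (Fin n → ℂ) → ℂ) : (Fin n → ℂ) → ℂ :=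
  fun z => (1 / 2 : ℂ) *
    (fderiv ℝ f z (Pi.single a 1) - Complex.I * fderiv ℝ f z (Pi.single a Complex.I))

/-- The Wirtinger anti-holomorphic derivative `∂/∂z̄_a` on `ℂⁿ`. -/
def dzbar (n : ℕ) (a : Fin n) (f : (Fin n → ℂ) → ℂ) : (Fin n → ℂ) → ℂ :=
  fun z => (1 / 2 : ℂ) *
    (fderiv ℝ f z (Pi.single a 1) + Complex.I * fderiv ℝ f z (Pi.single a Complex.I))

/-- The iterated mixed Wirtinger derivative `∂^{(A,B)}` with the prescribed
holomorphic indices `hs` and anti-holomorphic indices `as`. -/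
def mixedDeriv (n : ℕ) {A B : ℕ} (hs : Fin A → Fin n) (as : Fin B → Fin n)
    (f : (Fin n → ℂ) → ℂ) : (Fin n → ℂ) → ℂ :=
  (List.ofFn hs).foldr (fun a g => dz n a g)
    ((List.ofFn as).foldr (fun a g => dzbar n a g) f)

/-- `f : ℂⁿ → ℝ` is smooth and compactly supported. -/
def SmoothCpt (n : ℕ) (f : (Fin n → ℂ) → ℝ) : Prop :=
  ContDiff ℝ (⊤ : ℕ∞) f ∧ HasCompactSupport f

/-- A formal (complete or partial) contraction of degree `σ`, with `p` free
holomorphic indices and `q` free anti-holomorphic indices.  The factor on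
`ψ^j` carries `A j` holomorphic and `B j` anti-holomorphic index slots.
The bijection `pair` matches every holomorphic slot either with an
anti-holomorphic slot (a contracted pair) or with a free holomorphic label
in `Fin p`; a label `i : Fin q` on the left corresponds to the
anti-holomorphic slot `pair (Sum.inr i)`, which is the `i`-th free
anti-holomorphic index. -/
structure Term (σ p q : ℕ) where
  A : Fin σ → ℕ
  B : Fin σ → ℕ
  pair : ((Σ j : Fin σ, Fin (A j)) ⊕ Fin q) ≃ ((Σ j : Fin σ, Fin (B j)) ⊕ Fin p)
  okq : ∀ i : Fin q, (pair (Sum.inr i)).isLeft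
  okp : ∀ i : Fin p, (pair.symm (Sum.inr i)).isLeft

namespace Term

variable {σ p q : ℕ}

/-- The type of holomorphic index slots. -/
abbrev HoloIdx (T : Term σ p q) : Type := Σ j : Fin σ, Fin (T.A j)

/-- The type of anti-holomorphic index slots. -/
abbrev AntiIdx (T : Term σ p q) : Type := Σ j : Fin σ, Fin (T.B j)

open Classical in
/-- Evaluation of a formal contraction on the tuple `Ψ` of functions, with
values `fh` (resp. `fa`) assigned to the free holomorphic (resp.
anti-holomorphic) indices, at the point `z`.  Each contracted pair of indices
is summed over `Fin n`. -/
def eval (n : ℕ) (T : Term σ p q) (Ψ : Fin σ → (Fin n → ℂ) → ℝ)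
    (fh : Fin p → Fin n) (fa : Fin q → Fin n) (z : Fin n → ℂ) : ℂ :=
  ∑ v : (T.HoloIdx ⊕ Fin q) → Fin n,
    (if (∀ i : Fin q, v (Sum.inr i) = fa i) ∧
        (∀ (s : T.HoloIdx) (i : Fin p),
          T.pair (Sum.inl s) = Sum.inr i → v (Sum.inl s) = fh i)
      then (1 : ℂ) else 0) *
    ∏ j : Fin σ,
      mixedDeriv n (fun s : Fin (T.A j) => v (Sum.inl ⟨j, s⟩))
        (fun t : Fin (T.B j) => v (T.pair.symm (Sum.inl ⟨j, t⟩)))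
        (fun w => (Ψ j w : ℂ)) z

/-- The weight: the total number of contracted pairs. -/
def weight (T : Term σ p q) : ℕ := (∑ j, T.A j) - p

/-- The order `d = Σ_j (A_j + B_j - 4)`. -/
def order (T : Term σ p q) : ℕ := ∑ j, (T.A j + T.B j - 4)

/-- Acceptability: every factor has `A_j, B_j ≥ 2`. -/
def Acceptable (T : Term σ p q) : Prop := ∀ j, 2 ≤ T.A j ∧ 2 ≤ T.B j

/-- No trace: no contracted pair has both indices in the same factor. -/
def NoTraces (T : Term σ p q) : Prop :=
  ∀ (s : T.HoloIdx) (t : T.AntiIdx), T.pair (Sum.inl s) = Sum.inl t → t.1 ≠ s.1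

open Classical in
/-- The number of traces in factor `j`. -/
def tracesAt (T : Term σ p q) (j : Fin σ) : ℕ :=
  (Finset.univ.filter fun s : T.HoloIdx =>
    s.1 = j ∧ ∃ t : T.AntiIdx, T.pair (Sum.inl s) = Sum.inl t ∧ t.1 = j).card

open Classical in
/-- The height: the total number of traces. -/
def height (T : Term σ p q) : ℕ :=
  (Finset.univ.filter fun s : T.HoloIdx =>
    ∃ t : T.AntiIdx, T.pair (Sum.inl s) = Sum.inl t ∧ t.1 = s.1).card

open Classical in
/-- The number of contractions of an anti-holomorphic index of factor `i`
against a holomorphic index of factor `j` (denoted `Ψ^i_ā Ψ^j_a`). -/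
def specialCount (T : Term σ p q) (i j : Fin σ) : ℕ :=
  (Finset.univ.filter fun s : T.HoloIdx =>
    s.1 = j ∧ ∃ t : T.AntiIdx, T.pair (Sum.inl s) = Sum.inl t ∧ t.1 = i).card

open Classical in
/-- The number of contracted pairs with one index in factor `u` and the
other in factor `v`. -/
def linkCount (T : Term σ p q) (u v : Fin σ) : ℕ :=
  (Finset.univ.filter fun s : T.HoloIdx =>
    ∃ t : T.AntiIdx, T.pair (Sum.inl s) = Sum.inl t ∧
      ((s.1 = u ∧ t.1 = v) ∨ (s.1 = v ∧ t.1 = u))).card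

/-- `Π_l(h)`: the number of contractions `Ψ^1_ā Ψ^h_a` plus the number of
contractions `Ψ^h_ā Ψ^σ_a`. -/
def piCount (T : Term σ p q) (h : Fin σ) : ℕ :=
  T.specialCount ⟨0, h.pos⟩ h + T.specialCount h ⟨σ - 1, Nat.sub_lt h.pos Nat.one_pos⟩

/-- The free index (holomorphic or anti-holomorphic) does not belong to
factor `i`. -/
def FreeNotIn (T : Term σ p q) (i : Fin σ) : Prop :=
  (∀ s : T.HoloIdx, (∃ l : Fin p, T.pair (Sum.inl s) = Sum.inr l) → s.1 ≠ i) ∧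
  (∀ t : T.AntiIdx, (∃ l : Fin q, T.pair.symm (Sum.inl t) = Sum.inr l) → t.1 ≠ i)

end Term

/-- A restriction list `𝓛 ∈ {0,1,2}^{2σ}`. -/
structure RestrictionList (σ : ℕ) where
  α : Fin σ → ℕ
  β : Fin σ → ℕ
  hα : ∀ j, α j ≤ 2
  hβ : ∀ j, β j ≤ 2

/-- `𝓛`-acceptability: `A_j ≥ α_j` and `B_j ≥ β_j` for every `j`. -/
def Term.LAcc {σ p q : ℕ} (T : Term σ p q) (𝓛 : RestrictionList σ) : Prop :=
  ∀ j, 𝓛.α j ≤ T.A j ∧ 𝓛.β j ≤ T.B j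

/-- The order relative to a restriction list:
`d = Σ_j (A_j + B_j - α_j - β_j)`. -/
def Term.orderL {σ p q : ℕ} (T : Term σ p q) (𝓛 : RestrictionList σ) : ℕ :=
  ∑ j, (T.A j - 𝓛.α j + (T.B j - 𝓛.β j))

/-- A finite linear combination of formal contractions of degree `σ` with
`p` free holomorphic and `q` free anti-holomorphic indices. -/
structure LinComb (σ p q : ℕ) where
  N : ℕ
  coeff : Fin N → ℂ
  term : Fin N → Term σ p q

/-- Evaluation of a linear combination of formal contractions. -/
def LinComb.eval (n : ℕ) {σ p q : ℕ} (L : LinComb σ p q)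
    (Ψ : Fin σ → (Fin n → ℂ) → ℝ) (fh : Fin p → Fin n) (fa : Fin q → Fin n)
    (z : Fin n → ℂ) : ℂ :=
  ∑ i, L.coeff i * (L.term i).eval n Ψ fh fa z

open Classical in
/-- Evaluation of the sublinear combination consisting of the terms
satisfying `P`. -/
def LinComb.evalIf (n : ℕ) {σ p q : ℕ} (L : LinComb σ p q) (P : Fin L.N → Prop)
    (Ψ : Fin σ → (Fin n → ℂ) → ℝ) (fh : Fin p → Fin n) (fa : Fin q → Fin n)
    (z : Fin n → ℂ) : ℂ :=
  ∑ i, if P i then L.coeff i * (L.term i).eval n Ψ fh fa z else 0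

/-- The empty assignment of free indices. -/
def noFree {n : ℕ} : Fin 0 → Fin n := fun i => i.elim0

/-- The scalar invariant `L` integrates to zero in dimension `n`. -/
def IntegratesToZero (n : ℕ) {σ : ℕ} (L : LinComb σ 0 0) : Prop :=
  ∀ Ψ : Fin σ → (Fin n → ℂ) → ℝ, (∀ j, SmoothCpt n (Ψ j)) →
    ∫ z : Fin n → ℂ, L.eval n Ψ noFree noFree z = 0

/-- The scalar invariant `L(φ)` of a single function integrates to zero in
dimension `n`. -/
def IntegratesToZeroPhi (n : ℕ) {σ : ℕ} (L : LinComb σ 0 0) : Prop :=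
  ∀ φ : (Fin n → ℂ) → ℝ, SmoothCpt n φ →
    ∫ z : Fin n → ℂ, L.eval n (fun _ => φ) noFree noFree z = 0

/-- The divergence `∂_ā T_a` of a `(1,0)`-form valued invariant. -/
def divHolo (n : ℕ) {σ : ℕ} (T : LinComb σ 1 0)
    (Ψ : Fin σ → (Fin n → ℂ) → ℝ) (z : Fin n → ℂ) : ℂ :=
  ∑ a : Fin n, dzbar n a (fun w => T.eval n Ψ (fun _ => a) noFree w) z

/-- The divergence `∂_a T_ā` of a `(0,1)`-form valued invariant. -/
def divAnti (n : ℕ) {σ : ℕ} (T : LinComb σ 0 1)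
    (Ψ : Fin σ → (Fin n → ℂ) → ℝ) (z : Fin n → ℂ) : ℂ :=
  ∑ a : Fin n, dz n a (fun w => T.eval n Ψ noFree (fun _ => a) w) z

/-- Two formal contractions are formally equal if their index pairings can be
made to coincide by permuting the (barred, resp. unbarred) index slots on each
factor. -/
def FormallyEq {σ p q : ℕ} (T T' : Term σ p q) : Prop :=
  ∃ (e : T.HoloIdx ≃ T'.HoloIdx) (f : T.AntiIdx ≃ T'.AntiIdx),
    (∀ s : T.HoloIdx, (e s).1 = s.1) ∧ (∀ t : T.AntiIdx, (f t).1 = t.1) ∧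
    ∀ x : T.HoloIdx ⊕ Fin q,
      T'.pair (Sum.map (fun s => e s) id x) = Sum.map (fun t => f t) id (T.pair x)

open Classical in
/-- A linear combination of formal contractions vanishes formally: after
grouping formally equal contractions, all coefficients cancel. -/
def VanishesFormally {σ p q : ℕ} (L : LinComb σ p q) : Prop :=
  ∀ T₀ : Term σ p q,
    (∑ i : Fin L.N, if FormallyEq (L.term i) T₀ then L.coeff i else 0) = 0

/-- `T'` arises from `T` by erasing all the contracted pairs joining the
factors `u` and `v`. -/
def ErasesLinks {σ : ℕ} (u v : Fin σ) (T T' : Term σ 0 0) : Prop :=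
  ∃ (e : T'.HoloIdx ↪ T.HoloIdx) (f : T'.AntiIdx ↪ T.AntiIdx),
    (∀ s, (e s).1 = s.1) ∧ (∀ t, (f t).1 = t.1) ∧
    (∀ (s : T'.HoloIdx) (t : T'.AntiIdx),
      T'.pair (Sum.inl s) = Sum.inl t ↔ T.pair (Sum.inl (e s)) = Sum.inl (f t)) ∧
    (∀ s : T.HoloIdx, s ∉ Set.range e ↔
      ∃ t : T.AntiIdx, T.pair (Sum.inl s) = Sum.inl t ∧
        ((s.1 = u ∧ t.1 = v) ∨ (s.1 = v ∧ t.1 = u))) ∧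
    (∀ t : T.AntiIdx, t ∉ Set.range f ↔
      ∃ s : T.HoloIdx, T.pair (Sum.inl s) = Sum.inl t ∧
        ((s.1 = u ∧ t.1 = v) ∨ (s.1 = v ∧ t.1 = u)))

/-- The mixed fourth derivative `φ_{a c b̄ ē}` of a real function on `ℂⁿ`. -/
def phi4 (n : ℕ) (a c e₁ e₂ : Fin n) (φ : (Fin n → ℂ) → ℝ) : (Fin n → ℂ) → ℂ :=
  dz n a (dz n c (dzbar n e₁ (dzbar n e₂ (fun w => (φ w : ℂ)))))

/-- The `k`-Chern polynomial `I_{k_1,…,k_m}(φ) = (1/k!) contr(ch_{k_1,…,k_m}(φ))`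
attached to the partition `k = k 0 + ⋯ + k (m-1)`.  Explicitly, writing the
total index set as `Σ j, Fin (k j)` and letting the cyclic rotation act within
each block, it equals
`Σ_{a,b} Σ_{π} sgn(π) ∏_s φ_{a_s b_s ā_{rot s} b̄_{π s}}`. -/
def chernPoly (n m : ℕ) (k : Fin m → ℕ) (φ : (Fin n → ℂ) → ℝ)
    (z : Fin n → ℂ) : ℂ :=
  ∑ a : (Σ j : Fin m, Fin (k j)) → Fin n,
    ∑ b : (Σ j : Fin m, Fin (k j)) → Fin n,
      ∑ π : Equiv.Perm (Σ j : Fin m, Fin (k j)),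
        ((Equiv.Perm.sign π : ℤ) : ℂ) *
          ∏ s : Σ j : Fin m, Fin (k j),
            phi4 n (a s) (b s) (a ⟨s.1, finRotate (k s.1) s.2⟩) (b (π s)) φ z

/-- The term of maximum height `Δφ_{a_1 ā_2} Δφ_{a_2 ā_3} ⋯ Δφ_{a_k ā_1}`. -/
def maxHeightTerm (n k : ℕ) (φ : (Fin n → ℂ) → ℝ) (z : Fin n → ℂ) : ℂ :=
  ∑ a : Fin k → Fin n,
    ∏ i : Fin k, ∑ b : Fin n, phi4 n (a i) b (a (finRotate k i)) b φ z


section Wirtinger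

variable {n : ℕ} {f : (Fin n → ℂ) → ℂ}

lemma ContDiff.fderiv_apply_const (hf : ContDiff ℝ (⊤ : ℕ∞) f) (u : Fin n → ℂ) :
    ContDiff ℝ (⊤ : ℕ∞) (fun z => fderiv ℝ f z u) :=
  (hf.fderiv_right (m := (⊤ : ℕ∞)) (by simp)).clm_apply contDiff_const

lemma contDiff_dz (hf : ContDiff ℝ (⊤ : ℕ∞) f) (a : Fin n) :
    ContDiff ℝ (⊤ : ℕ∞) (dz n a f) :=
  contDiff_const.mul ((ContDiff.fderiv_apply_const hf _).sub
    (contDiff_const.mul (ContDiff.fderiv_apply_const hf _)))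

lemma contDiff_dzbar (hf : ContDiff ℝ (⊤ : ℕ∞) f) (a : Fin n) :
    ContDiff ℝ (⊤ : ℕ∞) (dzbar n a f) :=
  contDiff_const.mul ((ContDiff.fderiv_apply_const hf _).add
    (contDiff_const.mul (ContDiff.fderiv_apply_const hf _)))

lemma hasFDerivAt_fderiv_apply (hf : ContDiff ℝ (⊤ : ℕ∞) f) (u z : Fin n → ℂ) :
    HasFDerivAt (fun z => fderiv ℝ f z u) ((fderiv ℝ (fderiv ℝ f) z).flip u) z := by
  have h : DifferentiableAt ℝ (fderiv ℝ f) z :=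
    (hf.fderiv_right (m := (⊤ : ℕ∞)) (by simp)).differentiable (by simp) z
  simpa using h.hasFDerivAt.clm_apply (hasFDerivAt_const u z)

lemma fderiv_dz_apply (hf : ContDiff ℝ (⊤ : ℕ∞) f) (a : Fin n) (z x : Fin n → ℂ) :
    fderiv ℝ (dz n a f) z x = (1 / 2 : ℂ) * (fderiv ℝ (fderiv ℝ f) z x (Pi.single a 1) -
      Complex.I * fderiv ℝ (fderiv ℝ f) z x (Pi.single a Complex.I)) := by
  have h := ((hasFDerivAt_fderiv_apply hf (Pi.single a 1) z).sub
    ((hasFDerivAt_fderiv_apply hf (Pi.single a Complex.I) z).const_mul Complex.I)).const_mul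
      (1 / 2 : ℂ)
  have h' : HasFDerivAt (dz n a f) _ z := h
  rw [h'.fderiv]
  simp

lemma fderiv_dzbar_apply (hf : ContDiff ℝ (⊤ : ℕ∞) f) (a : Fin n) (z x : Fin n → ℂ) :
    fderiv ℝ (dzbar n a f) z x = (1 / 2 : ℂ) * (fderiv ℝ (fderiv ℝ f) z x (Pi.single a 1) +
      Complex.I * fderiv ℝ (fderiv ℝ f) z x (Pi.single a Complex.I)) := by
  have h := ((hasFDerivAt_fderiv_apply hf (Pi.single a 1) z).add
    ((hasFDerivAt_fderiv_apply hf (Pi.single a Complex.I) z).const_mul Complex.I)).const_mul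
      (1 / 2 : ℂ)
  have h' : HasFDerivAt (dzbar n a f) _ z := h
  rw [h'.fderiv]
  simp [mul_add]

lemma fderiv_fderiv_comm (hf : ContDiff ℝ (⊤ : ℕ∞) f) (z x y : Fin n → ℂ) :
    fderiv ℝ (fderiv ℝ f) z x y = fderiv ℝ (fderiv ℝ f) z y x :=
  (hf.contDiffAt.isSymmSndFDerivAt (by simp only [minSmoothness_of_isRCLikeNormedField]; exact WithTop.coe_le_coe.mpr (mod_cast le_top))).eq x y

lemma dz_comm (hf : ContDiff ℝ (⊤ : ℕ∞) f) (a b : Fin n) :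
    dz n a (dz n b f) = dz n b (dz n a f) := by
  funext z
  change (1 / 2 : ℂ) * (fderiv ℝ (dz n b f) z _ - Complex.I * fderiv ℝ (dz n b f) z _) =
    (1 / 2 : ℂ) * (fderiv ℝ (dz n a f) z _ - Complex.I * fderiv ℝ (dz n a f) z _)
  simp only [fderiv_dz_apply hf]
  rw [fderiv_fderiv_comm hf z (Pi.single b 1) (Pi.single a 1),
    fderiv_fderiv_comm hf z (Pi.single b 1) (Pi.single a Complex.I),
    fderiv_fderiv_comm hf z (Pi.single b Complex.I) (Pi.single a 1),
    fderiv_fderiv_comm hf z (Pi.single b Complex.I) (Pi.single a Complex.I)]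
  ring

lemma dzbar_comm (hf : ContDiff ℝ (⊤ : ℕ∞) f) (a b : Fin n) :
    dzbar n a (dzbar n b f) = dzbar n b (dzbar n a f) := by
  funext z
  change (1 / 2 : ℂ) * (fderiv ℝ (dzbar n b f) z _ + Complex.I * fderiv ℝ (dzbar n b f) z _) =
    (1 / 2 : ℂ) * (fderiv ℝ (dzbar n a f) z _ + Complex.I * fderiv ℝ (dzbar n a f) z _)
  simp only [fderiv_dzbar_apply hf]
  rw [fderiv_fderiv_comm hf z (Pi.single b 1) (Pi.single a 1),
    fderiv_fderiv_comm hf z (Pi.single b 1) (Pi.single a Complex.I),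
    fderiv_fderiv_comm hf z (Pi.single b Complex.I) (Pi.single a 1),
    fderiv_fderiv_comm hf z (Pi.single b Complex.I) (Pi.single a Complex.I)]
  ring

lemma SmoothCpt.contDiff_ofReal {φ : (Fin n → ℂ) → ℝ} (hφ : SmoothCpt n φ) :
    ContDiff ℝ (⊤ : ℕ∞) (fun w => (φ w : ℂ)) :=
  Complex.ofRealCLM.contDiff.comp hφ.1

lemma phi4_comm_holo {φ : (Fin n → ℂ) → ℝ} (hφ : SmoothCpt n φ) (a c e₁ e₂ : Fin n) :
    phi4 n a c e₁ e₂ φ = phi4 n c a e₁ e₂ φ :=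
  dz_comm (contDiff_dzbar (contDiff_dzbar hφ.contDiff_ofReal _) _) a c

lemma phi4_comm_anti {φ : (Fin n → ℂ) → ℝ} (hφ : SmoothCpt n φ) (a c e₁ e₂ : Fin n) :
    phi4 n a c e₁ e₂ φ = phi4 n a c e₂ e₁ φ := by
  unfold phi4
  rw [dzbar_comm hφ.contDiff_ofReal e₁ e₂]

/-- `phi4` is unchanged when the index slots of either kind are cyclically shifted. -/
lemma phi4_shift {φ : (Fin n → ℂ) → ℝ} (hφ : SmoothCpt n φ) (v w : Fin 2 → Fin n)
    (x y : Fin 2) :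
    phi4 n (v (0 + x)) (v (1 + x)) (w (0 + y)) (w (1 + y)) φ =
      phi4 n (v 0) (v 1) (w 0) (w 1) φ := by
  have h : (1 : Fin 2) + 1 = 0 := rfl
  fin_cases x <;> fin_cases y <;> simp [h]
  · exact phi4_comm_anti hφ _ _ _ _
  · exact phi4_comm_holo hφ _ _ _ _
  · rw [phi4_comm_holo hφ, phi4_comm_anti hφ]

end Wirtinger

section Slots

variable {σ : ℕ}

/-- The index slots of one kind for `σ` factors with two slots each. -/
abbrev Slot (σ : ℕ) : Type := Σ _ : Fin σ, Fin 2

/-- The complete contraction in factors of type `(2,2)` in which the anti-holomorphic slot `t`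
is contracted with the holomorphic slot `Q t`. -/
def ofPerm (Q : Equiv.Perm (Slot σ)) : Term σ 0 0 where
  A := fun _ => 2
  B := fun _ => 2
  pair := Equiv.sumCongr Q.symm (Equiv.refl _)
  okq := fun i => i.elim0
  okp := fun i => i.elim0

lemma exists_eq_ofPerm (T : Term σ 0 0) (hT : ∀ j, T.A j = 2 ∧ T.B j = 2) :
    ∃ Q, T = ofPerm Q := by
  obtain ⟨A, B, pair, okq, okp⟩ := T
  obtain rfl : A = fun _ => 2 := funext fun j => (hT j).1
  obtain rfl : B = fun _ => 2 := funext fun j => (hT j).2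
  refine ⟨((Equiv.sumEmpty _ _).symm.trans (pair.trans (Equiv.sumEmpty _ _))).symm, ?_⟩
  unfold ofPerm
  congr 1
  ext1 x
  rcases x with x | x
  · rcases h : pair (Sum.inl x) with y | y
    · simp [h]
    · exact y.elim0
  · exact x.elim0

/-- The value of the contraction `ofPerm Q` on a single function. -/
def slotEval (Q : Equiv.Perm (Slot σ)) (n : ℕ) (φ : (Fin n → ℂ) → ℝ) (z : Fin n → ℂ) : ℂ :=
  ∑ v : Slot σ → Fin n, ∏ j : Fin σ,
    phi4 n (v ⟨j, 0⟩) (v ⟨j, 1⟩) (v (Q ⟨j, 0⟩)) (v (Q ⟨j, 1⟩)) φ z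

lemma eval_ofPerm (Q : Equiv.Perm (Slot σ)) (n : ℕ) (φ : (Fin n → ℂ) → ℝ) (z : Fin n → ℂ) :
    (ofPerm Q).eval n (fun _ => φ) noFree noFree z = slotEval Q n φ z := by
  unfold Term.eval slotEval
  refine Fintype.sum_equiv ((Equiv.sumEmpty (Slot σ) (Fin 0)).arrowCongr (Equiv.refl (Fin n)))
    _ _ fun v => ?_
  rw [if_pos ⟨fun i => i.elim0, fun _ i => i.elim0⟩, one_mul]
  rfl

/-- Every factor of the contraction carries a trace. -/
def AllTraced (Q : Equiv.Perm (Slot σ)) : Prop := ∀ j, ∃ x, (Q ⟨j, x⟩).1 = j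

lemma exists_tracesAt_eq_zero {Q : Equiv.Perm (Slot σ)} (hQ : ¬ AllTraced Q) :
    ∃ j, (ofPerm Q).tracesAt j = 0 := by
  unfold AllTraced at hQ
  push Not at hQ
  obtain ⟨j, hj⟩ := hQ
  refine ⟨j, ?_⟩
  unfold Term.tracesAt
  rw [Finset.card_eq_zero, Finset.filter_eq_empty_iff]
  rintro s - ⟨hs, ⟨i, x⟩, ht, rfl⟩
  have h : Q.symm s = ⟨i, x⟩ := Sum.inl_injective ht
  exact hj x ((congrArg Sigma.fst ((Equiv.symm_apply_eq Q).mp h)).symm.trans hs)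

/-- Shift the two slots of the factor `j` cyclically by `x j`. -/
def shift (x : Fin σ → Fin 2) : Equiv.Perm (Slot σ) :=
  Equiv.sigmaCongrRight fun j => Equiv.addRight (x j)

lemma slotEval_shift {n : ℕ} {φ : (Fin n → ℂ) → ℝ} (hφ : SmoothCpt n φ)
    (Q : Equiv.Perm (Slot σ)) (x y : Fin σ → Fin 2) (z : Fin n → ℂ) :
    slotEval ((shift x).symm * Q * shift y) n φ z = slotEval Q n φ z := by
  unfold slotEval
  refine Fintype.sum_equiv ((shift x).arrowCongr (Equiv.refl (Fin n))) _ _ fun v => ?_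
  refine Finset.prod_congr rfl fun j _ => ?_
  refine congrFun ?_ z
  have h := phi4_shift hφ (fun i => v ((shift x).symm ⟨j, i⟩))
    (fun i => v ((shift x).symm (Q ⟨j, i⟩))) (x j) (y j)
  refine Eq.trans ?_ h
  have h0 (i : Fin 2) : (shift x).symm ⟨j, i + x j⟩ = ⟨j, i⟩ := by
    rw [Equiv.symm_apply_eq]; rfl
  simp only [h0]
  rfl

/-- The permutation of slots acting by `α` on first slots and by `β` on second slots. -/
def pairSlots (α β : Equiv.Perm (Fin σ)) : Equiv.Perm (Slot σ) where
  toFun s := ⟨if s.2 = 0 then α s.1 else β s.1, s.2⟩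
  invFun s := ⟨if s.2 = 0 then α.symm s.1 else β.symm s.1, s.2⟩
  left_inv := by rintro ⟨j, x⟩; by_cases h : x = 0 <;> simp [h]
  right_inv := by rintro ⟨j, x⟩; by_cases h : x = 0 <;> simp [h]

@[simp]
lemma pairSlots_zero (α β : Equiv.Perm (Fin σ)) (j : Fin σ) :
    pairSlots α β ⟨j, 0⟩ = ⟨α j, 0⟩ := rfl

@[simp]
lemma pairSlots_one (α β : Equiv.Perm (Fin σ)) (j : Fin σ) :
    pairSlots α β ⟨j, 1⟩ = ⟨β j, 1⟩ := rfl

lemma exists_eq_pairSlots_one (Q : Equiv.Perm (Slot σ)) (hQ : ∀ j, Q ⟨j, 1⟩ = ⟨j, 1⟩) :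
    ∃ τ : Equiv.Perm (Fin σ), Q = pairSlots τ 1 := by
  have h0 : ∀ j, ∃ i, Q ⟨j, 0⟩ = ⟨i, 0⟩ := by
    intro j
    rcases h : Q ⟨j, 0⟩ with ⟨i, x⟩
    fin_cases x
    · exact ⟨i, rfl⟩
    · have := Q.injective (h.trans (hQ i).symm)
      simp at this
  choose τ hτ using h0
  have hinj : Function.Injective τ := fun i j hij => by
    have := Q.injective ((hτ i).trans ((congrArg (Sigma.mk · (0 : Fin 2)) hij).trans (hτ j).symm))
    simpa using this
  refine ⟨Equiv.ofBijective τ (Finite.injective_iff_bijective.mp hinj), ?_⟩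
  ext1 ⟨j, x⟩
  fin_cases x
  · exact hτ j
  · exact hQ j

/-- A contraction all of whose factors are traced is a product of cycles of once-traced
factors. -/
lemma exists_slotEval_eq {Q : Equiv.Perm (Slot σ)} (hQ : AllTraced Q) :
    ∃ τ : Equiv.Perm (Fin σ), (∀ j, τ j = j → ∀ x, (Q ⟨j, x⟩).1 = j) ∧
      ∀ (n : ℕ) (φ : (Fin n → ℂ) → ℝ), SmoothCpt n φ → ∀ z : Fin n → ℂ,
        slotEval Q n φ z = slotEval (pairSlots τ 1) n φ z := by
  choose y hy using hQ
  set g := shift fun j => (Q ⟨j, y j⟩).2 + 1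
  set h := shift fun j => y j + 1
  have h11 : ∀ a : Fin 2, 1 + (a + 1) = a := by decide
  obtain ⟨τ, hτ⟩ := exists_eq_pairSlots_one (g.symm * Q * h) fun j => by
    change g.symm (Q ⟨j, 1 + (y j + 1)⟩) = _
    rw [h11, Equiv.symm_apply_eq]
    change _ = (⟨j, 1 + ((Q ⟨j, y j⟩).2 + 1)⟩ : Slot σ)
    rw [h11]
    exact Sigma.ext (hy j) HEq.rfl
  refine ⟨τ, fun j hj => ?_, fun n φ hφ z => ?_⟩
  · have key : ∀ x, (Q (h ⟨j, x⟩)).1 = j := by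
      intro x
      have e : g.symm (Q (h ⟨j, x⟩)) = pairSlots τ 1 ⟨j, x⟩ := by rw [← hτ]; rfl
      rw [Equiv.symm_apply_eq] at e
      rw [e]
      fin_cases x
      · exact hj
      · rfl
    intro x
    have := key (x - (y j + 1))
    have e : h ⟨j, x - (y j + 1)⟩ = ⟨j, x⟩ :=
      congrArg (Sigma.mk j) (sub_add_cancel x (y j + 1))
    rwa [e] at this
  · rw [← hτ, slotEval_shift hφ]

lemma slotEval_pairSlots (α β : Equiv.Perm (Fin σ)) (n : ℕ) (φ : (Fin n → ℂ) → ℝ)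
    (z : Fin n → ℂ) :
    slotEval (pairSlots α β) n φ z = ∑ a : Fin σ → Fin n, ∑ b : Fin σ → Fin n,
      ∏ j, phi4 n (a j) (b j) (a (α j)) (b (β j)) φ z := by
  rw [← Fintype.sum_prod_type']
  refine Fintype.sum_equiv
    { toFun := fun v => (fun j => v ⟨j, 0⟩, fun j => v ⟨j, 1⟩)
      invFun := fun p s => if s.2 = 0 then p.1 s.1 else p.2 s.1
      left_inv := fun v => ?_
      right_inv := fun p => ?_ } _ _ fun v => ?_
  · funext ⟨j, x⟩
    fin_cases x <;> rfl
  · rfl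
  · rfl

end Slots

section Chern

variable {σ : ℕ}

/-- Every permutation is conjugate to a block rotation. -/
lemma exists_blockRotation (τ : Equiv.Perm (Fin σ)) (hσ : 0 < σ) :
    ∃ (m : ℕ) (k : Fin m → ℕ) (e : (Σ j : Fin m, Fin (k j)) ≃ Fin σ),
      0 < m ∧ (∀ j, 1 ≤ k j) ∧ ∑ j, k j = σ ∧
      ∀ s, e ⟨s.1, finRotate (k s.1) s.2⟩ = τ (e s) := by
  classical
  let C := Quotient (Equiv.Perm.SameCycle.setoid τ)
  let c : Fin (Fintype.card C) ≃ C := (Fintype.equivFin C).symm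
  let r : Fin (Fintype.card C) → Fin σ := fun i => (c i).out
  let k : Fin (Fintype.card C) → ℕ := fun i => Function.minimalPeriod τ (r i)
  have hk : ∀ i, 0 < k i := fun i =>
    Function.minimalPeriod_pos_of_mem_periodicPts
      ((Function.Injective.mem_periodicPts τ.injective) (r i))
  let f : (Σ j, Fin (k j)) → Fin σ := fun s => τ^[s.2] (r s.1)
  have hcyc : ∀ s, τ.SameCycle (r s.1) (f s) := fun s =>
    ⟨(s.2 : ℕ), by simp [f, Equiv.Perm.iterate_eq_pow]⟩
  have hf : Function.Bijective f := by
    constructor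
    · rintro ⟨i, x⟩ ⟨j, y⟩ h
      have h1 : τ.SameCycle (r i) (r j) := by
        have := hcyc ⟨i, x⟩
        rw [h] at this
        exact this.trans (hcyc ⟨j, y⟩).symm
      obtain rfl : i = j := by
        apply c.injective
        rw [← (c i).out_eq, ← (c j).out_eq]
        exact Quotient.sound h1
      have h2 := Function.iterate_injOn_Iio_minimalPeriod (f := τ) (x := r i) x.2 y.2 h
      rw [Fin.ext h2]
    · intro y
      have h1 : τ.SameCycle (r (c.symm (Quotient.mk _ y))) y := by
        simp only [r, Equiv.apply_symm_apply]
        exact Quotient.mk_out (s := Equiv.Perm.SameCycle.setoid τ) y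
      obtain ⟨i, hi⟩ := h1.exists_nat_pow_eq
      refine ⟨⟨c.symm (Quotient.mk _ y), ⟨i % k _, Nat.mod_lt _ (hk _)⟩⟩, ?_⟩
      simp only [f, k, Function.iterate_mod_minimalPeriod_eq]
      rw [Equiv.Perm.iterate_eq_pow, hi]
  refine ⟨Fintype.card C, k, Equiv.ofBijective f hf, ?_, hk, ?_, ?_⟩
  · exact Fintype.card_pos_iff.mpr ⟨Quotient.mk _ ⟨0, hσ⟩⟩
  · simpa using Fintype.card_congr (Equiv.ofBijective f hf)
  · rintro ⟨i, x⟩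
    change τ^[(finRotate (k i) x : ℕ)] (r i) = τ (τ^[x] (r i))
    rw [← Function.iterate_succ_apply' τ, ← Function.iterate_mod_minimalPeriod_eq (n := x + 1)]
    change _ = τ^[((x : ℕ) + 1) % k i] (r i)
    congr 2
    clear_value k
    generalize k i = K at x
    cases K with
    | zero => exact x.elim0
    | succ K => rw [finRotate_apply, Fin.val_add, Fin.val_one', Nat.add_mod_mod]

lemma chernPoly_eq {m : ℕ} {k : Fin m → ℕ} (e : (Σ j : Fin m, Fin (k j)) ≃ Fin σ)
    {τ : Equiv.Perm (Fin σ)} (he : ∀ s, e ⟨s.1, finRotate (k s.1) s.2⟩ = τ (e s))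
    (n : ℕ) (φ : (Fin n → ℂ) → ℝ) (z : Fin n → ℂ) :
    chernPoly n m k φ z = ∑ π : Equiv.Perm (Fin σ),
      ((Equiv.Perm.sign π : ℤ) : ℂ) * slotEval (pairSlots τ π) n φ z := by
  have h1 : chernPoly n m k φ z = ∑ a : Fin σ → Fin n, ∑ b : Fin σ → Fin n,
      ∑ π : Equiv.Perm (Fin σ), ((Equiv.Perm.sign π : ℤ) : ℂ) *
        ∏ j, phi4 n (a j) (b j) (a (τ j)) (b (π j)) φ z := by
    refine Fintype.sum_equiv (e.arrowCongr (Equiv.refl _)) _ _ fun a => ?_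
    refine Fintype.sum_equiv (e.arrowCongr (Equiv.refl _)) _ _ fun b => ?_
    refine Fintype.sum_equiv e.permCongr _ _ fun π => ?_
    rw [Equiv.Perm.sign_permCongr]
    congr 1
    refine Fintype.prod_equiv e _ _ fun s => ?_
    simp [← he]
  rw [h1, Finset.sum_congr rfl fun a _ => Finset.sum_comm, Finset.sum_comm]
  simp only [slotEval_pairSlots, Finset.mul_sum]

/-- The points at which contractions are evaluated. -/
abbrev EvalPt : Type := Σ n : ℕ, {φ : (Fin n → ℂ) → ℝ // SmoothCpt n φ} × (Fin n → ℂ)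

/-- The Chern polynomials of degree `σ`, as functions on `EvalPt`. -/
def chernSet (σ : ℕ) : Set (EvalPt → ℂ) :=
  {F | ∃ (m : ℕ) (k : Fin m → ℕ), 0 < m ∧ (∀ j, 1 ≤ k j) ∧ ∑ j, k j = σ ∧
    F = fun p => chernPoly p.1 m k p.2.1 p.2.2}

/-- The contractions of type `(2,2)` with a trace-free factor, as functions on `EvalPt`. -/
def sharpSet (σ : ℕ) : Set (EvalPt → ℂ) :=
  {F | ∃ T : Term σ 0 0, (∀ j, T.A j = 2 ∧ T.B j = 2) ∧ (∃ j, T.tracesAt j = 0) ∧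
    F = fun p => T.eval p.1 (fun _ => p.2.1) noFree noFree p.2.2}

/-- The value of `ofPerm Q`, as a function on `EvalPt`. -/
def slotFun (Q : Equiv.Perm (Slot σ)) : EvalPt → ℂ := fun p => slotEval Q p.1 p.2.1 p.2.2

lemma slotFun_mem_of_not_allTraced {Q : Equiv.Perm (Slot σ)} (hQ : ¬ AllTraced Q) :
    slotFun Q ∈ Submodule.span ℂ (sharpSet σ) :=
  Submodule.subset_span ⟨ofPerm Q, fun _ => ⟨rfl, rfl⟩, exists_tracesAt_eq_zero hQ,
    funext fun _ => (eval_ofPerm Q _ _ _).symm⟩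

lemma slotFun_pairSlots_one_mem (hσ : 0 < σ) (τ : Equiv.Perm (Fin σ)) :
    slotFun (pairSlots τ 1) ∈
      Submodule.span ℂ (chernSet σ) ⊔ Submodule.span ℂ (sharpSet σ) := by
  induction hN : (Finset.univ.filter fun j => τ j = j).card using Nat.strong_induction_on
    generalizing τ with
  | _ N ih =>
  subst hN
  obtain ⟨m, k, e, hm, hk, hsum, he⟩ := exists_blockRotation τ hσ
  have hsplit : slotFun (pairSlots τ 1) = (fun p => chernPoly p.1 m k p.2.1 p.2.2) -
      ∑ π ∈ Finset.univ.erase (1 : Equiv.Perm (Fin σ)),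
        ((Equiv.Perm.sign π : ℤ) : ℂ) • slotFun (pairSlots τ π) := by
    funext p
    have h := chernPoly_eq e he p.1 p.2.1 p.2.2
    rw [← Finset.add_sum_erase _ _ (Finset.mem_univ (1 : Equiv.Perm (Fin σ)))] at h
    simp [h, slotFun]
  rw [hsplit]
  refine Submodule.sub_mem _ (Submodule.mem_sup_left (Submodule.subset_span
    ⟨m, k, hm, hk, hsum, rfl⟩)) (Submodule.sum_mem _ fun π hπ => Submodule.smul_mem _ _ ?_)
  by_cases hQ : AllTraced (pairSlots τ π)
  · obtain ⟨ρ, hρ, heq⟩ := exists_slotEval_eq hQ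
    have : slotFun (pairSlots τ π) = slotFun (pairSlots ρ 1) :=
      funext fun p => heq p.1 p.2.1 p.2.1.2 p.2.2
    rw [this]
    refine ih _ (Finset.card_lt_card ?_) ρ rfl
    obtain ⟨j, hj⟩ : ∃ j, π j ≠ j := by
      by_contra! h
      exact (Finset.ne_of_mem_erase hπ) (Equiv.ext h)
    rw [Finset.ssubset_iff_of_subset fun i hi => by simpa using hρ i (by simpa using hi) 0]
    refine ⟨j, ?_, fun hj' => hj ?_⟩
    · obtain ⟨x, hx⟩ := hQ j
      fin_cases x
      · simpa using hx
      · exact absurd hx hj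
    · simpa using hρ j (by simpa using hj') 1
  · exact Submodule.mem_sup_right (slotFun_mem_of_not_allTraced hQ)

lemma slotFun_mem (hσ : 0 < σ) (Q : Equiv.Perm (Slot σ)) :
    slotFun Q ∈ Submodule.span ℂ (chernSet σ) ⊔ Submodule.span ℂ (sharpSet σ) := by
  by_cases hQ : AllTraced Q
  · obtain ⟨ρ, -, heq⟩ := exists_slotEval_eq hQ
    have : slotFun Q = slotFun (pairSlots ρ 1) := funext fun p => heq p.1 p.2.1 p.2.1.2 p.2.2
    rw [this]
    exact slotFun_pairSlots_one_mem hσ ρ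
  · exact Submodule.mem_sup_right (slotFun_mem_of_not_allTraced hQ)

end Chern

/-- Lemma 4.3: every linear combination of complete
contractions of degree `σ` in factors `∂^{(2,2)}φ` equals a linear
combination of `σ`-Chern polynomials plus a linear combination of such
complete contractions each having at least one trace-free factor. -/
theorem chern_decomposition {σ : ℕ} (hσ : 0 < σ) (L : LinComb σ 0 0)
    (h22 : ∀ r j, (L.term r).A j = 2 ∧ (L.term r).B j = 2) :
    ∃ (M : ℕ) (mm : Fin M → ℕ) (kk : ∀ r : Fin M, Fin (mm r) → ℕ)
      (c : Fin M → ℂ) (Lsharp : LinComb σ 0 0),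
      (∀ r, 0 < mm r) ∧ (∀ r j, 1 ≤ kk r j) ∧ (∀ r, ∑ j, kk r j = σ) ∧
      (∀ r j, (Lsharp.term r).A j = 2 ∧ (Lsharp.term r).B j = 2) ∧
      (∀ r, ∃ j, (Lsharp.term r).tracesAt j = 0) ∧
      ∀ (n : ℕ) (φ : (Fin n → ℂ) → ℝ), SmoothCpt n φ → ∀ z : Fin n → ℂ,
        L.eval n (fun _ => φ) noFree noFree z =
          (∑ r, c r * chernPoly n (mm r) (kk r) φ z) +
            Lsharp.eval n (fun _ => φ) noFree noFree z := by
  choose Q hQ using fun r => exists_eq_ofPerm (L.term r) (h22 r)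
  have hmem : ∑ r, L.coeff r • slotFun (Q r) ∈
      Submodule.span ℂ (chernSet σ) ⊔ Submodule.span ℂ (sharpSet σ) :=
    Submodule.sum_mem _ fun r _ => Submodule.smul_mem _ _ (slotFun_mem hσ (Q r))
  obtain ⟨F, hF, G, hG, hFG⟩ := Submodule.mem_sup.mp hmem
  obtain ⟨M, c, f, rfl⟩ := Submodule.mem_span_set'.mp hF
  obtain ⟨N, d, g, rfl⟩ := Submodule.mem_span_set'.mp hG
  choose mm kk hm hk hsum hf using fun r => (f r).2
  choose T hT htr hg using fun r => (g r).2
  refine ⟨M, mm, kk, c, ⟨N, d, T⟩, hm, hk, hsum, hT, htr, fun n φ hφ z => ?_⟩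
  have h := congrFun hFG ⟨n, ⟨φ, hφ⟩, z⟩
  simp only [Pi.add_apply, Finset.sum_apply, Pi.smul_apply, hf, hg, smul_eq_mul, slotFun] at h
  simp only [LinComb.eval, hQ, eval_ofPerm]
  exact h.symm

end KahlerInv
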